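/- arXiv:1412.4324 — 8 statements merged into one kernel-verified Lean document; each statement's English description precedes it below -/
import Mathlib

section
/- Suppose 2s̄ ≤ p. Then the following are equivalent: (i) the system is 2s̄-sparse observable; (ii) for all states x₁, x₂ ∈ ℝⁿ and all block-s̄-sparse block vectors E₁, E₂, if O_i x₁ + (E₁)_i = O_i x₂ + (E₂)_i for every i ∈ {1,…,p}, then x₁ = x₂. (This is the existence-and-uniqueness theorem for the noiseless secure state estimation problem.) -/
/-- The system with observability blocks `O i ∈ ℝ^{τ×n}` is `s`-sparse observable if for
every `Γ ⊆ {1,…,p}` with `|Γ| = s`, the stacked matrix over the complement of `Γ` has a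
trivial kernel. -/
def SparseObservable {p τ n : ℕ} (O : Fin p → Matrix (Fin τ) (Fin n) ℝ) (s : ℕ) : Prop :=
  ∀ Γ : Finset (Fin p), Γ.card = s →
    ∀ x : Fin n → ℝ, (∀ i ∈ Γᶜ, (O i).mulVec x = 0) → x = 0

/-- A block vector `E = (E_1,…,E_p)` with `E_i ∈ ℝ^τ` is block-`s`-sparse if at most `s`
of its blocks are nonzero. -/
def BlockSparse {p τ : ℕ} (E : Fin p → Fin τ → ℝ) (s : ℕ) : Prop :=
  ∃ S : Finset (Fin p), S.card ≤ s ∧ ∀ i ∉ S, E i = 0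

/-- Suppose 2s̄ ≤ p. Then the following are equivalent: (i) the system is
2s̄-sparse observable; (ii) for all states x₁, x₂ ∈ ℝⁿ and all block-s̄-sparse block
vectors E₁, E₂, if O_i x₁ + (E₁)_i = O_i x₂ + (E₂)_i for every i ∈ {1,…,p}, then x₁ = x₂. -/
theorem stmt_2 {p τ n : ℕ} (sbar : ℕ) (hs : 2 * sbar ≤ p)
    (O : Fin p → Matrix (Fin τ) (Fin n) ℝ) :
    SparseObservable O (2 * sbar) ↔
      ∀ (x₁ x₂ : Fin n → ℝ) (E₁ E₂ : Fin p → Fin τ → ℝ),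
        BlockSparse E₁ sbar → BlockSparse E₂ sbar →
        (∀ i : Fin p, (O i).mulVec x₁ + E₁ i = (O i).mulVec x₂ + E₂ i) →
        x₁ = x₂ := by
  constructor
  · rintro h x₁ x₂ E₁ E₂ ⟨S₁, hS₁, hE₁⟩ ⟨S₂, hS₂, hE₂⟩ hE
    have hcard : (S₁ ∪ S₂).card ≤ 2 * sbar := by
      have := Finset.card_union_le S₁ S₂
      omega
    obtain ⟨Γ, hsub, hΓ⟩ := Finset.exists_superset_card_eq hcard (by simpa using hs)
    have hx := h Γ hΓ (x₁ - x₂) (by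
      intro i hi
      have hi' : i ∉ S₁ ∪ S₂ := fun hmem => (Finset.mem_compl.mp hi) (hsub hmem)
      rw [Finset.mem_union, not_or] at hi'
      have := hE i
      rw [hE₁ i hi'.1, hE₂ i hi'.2, add_zero, add_zero] at this
      rw [Matrix.mulVec_sub, this, sub_self])
    exact sub_eq_zero.mp hx
  · intro h Γ hΓ x hx
    obtain ⟨S, hSΓ, hS⟩ := Finset.exists_subset_card_eq (s := Γ) (n := sbar) (by omega)
    refine h x 0 (fun i => if i ∈ S then -(O i).mulVec x else 0)
      (fun i => if i ∈ Γ \ S then (O i).mulVec x else 0)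
      ⟨S, hS.le, fun i hi => if_neg hi⟩ ⟨Γ \ S, ?_, fun i hi => if_neg hi⟩ ?_
    · rw [Finset.card_sdiff_of_subset hSΓ]
      omega
    · intro i
      by_cases h1 : i ∈ S
      · simp [h1]
      · by_cases h2 : i ∈ Γ
        · simp [h1, h2]
        · simp [h1, h2, hx i (Finset.mem_compl.mpr h2)]
end

section
/- Suppose 2s̄ ≤ p, the system is 2s̄-sparse observable, and the measurements satisfy Y_i = O_i x* + E*_i for all i ∈ {1,…,p}, where x* ∈ ℝⁿ and E* is block-s̄-sparse. Let I ⊆ {1,…,p} with |I| ≥ p − s̄. Then there exists x ∈ ℝⁿ with O_i x = Y_i for all i ∈ I if and only if E*_i = 0 for all i ∈ I; moreover, any x satisfying O_i x = Y_i for all i ∈ I equals x*. -/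
/-- Suppose 2s̄ ≤ p, the system is 2s̄-sparse observable, and the measurements
satisfy Y_i = O_i x* + E*_i for all i, where E* is block-s̄-sparse. Let I ⊆ {1,…,p} with
|I| ≥ p − s̄. Then there exists x with O_i x = Y_i for all i ∈ I iff E*_i = 0 for all i ∈ I;
moreover any x satisfying O_i x = Y_i for all i ∈ I equals x*. -/
theorem stmt_3 {p τ n : ℕ} (sbar : ℕ) (hs : 2 * sbar ≤ p)
    (O : Fin p → Matrix (Fin τ) (Fin n) ℝ)
    (hobs : SparseObservable O (2 * sbar))
    (Y Estar : Fin p → Fin τ → ℝ) (xstar : Fin n → ℝ)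
    (hY : ∀ i : Fin p, Y i = (O i).mulVec xstar + Estar i)
    (hE : BlockSparse Estar sbar)
    (I : Finset (Fin p)) (hI : p - sbar ≤ I.card) :
    ((∃ x : Fin n → ℝ, ∀ i ∈ I, (O i).mulVec x = Y i) ↔ (∀ i ∈ I, Estar i = 0)) ∧
      (∀ x : Fin n → ℝ, (∀ i ∈ I, (O i).mulVec x = Y i) → x = xstar) := by
  have key : ∀ x : Fin n → ℝ, (∀ i ∈ I, (O i).mulVec x = Y i) → x = xstar := by
    intro x hx
    obtain ⟨S, hS, hS0⟩ := hE
    have hc : (S ∪ Iᶜ).card ≤ 2 * sbar := by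
      have h1 := Finset.card_union_le S Iᶜ
      have h2 : Iᶜ.card = p - I.card := by simp [Finset.card_compl]
      omega
    obtain ⟨G, hG, hGc⟩ := Finset.exists_superset_card_eq hc (by simpa using hs)
    have h0 := hobs G hGc (x - xstar) (by
      intro i hi
      have hi' : i ∉ S ∪ Iᶜ := fun h => (Finset.mem_compl.mp hi) (hG h)
      simp only [Finset.mem_union, Finset.mem_compl, not_or, not_not] at hi'
      rw [Matrix.mulVec_sub, hx i hi'.2, hY i, hS0 i hi'.1]
      simp)
    exact sub_eq_zero.mp h0
  refine ⟨⟨?_, ?_⟩, key⟩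
  · rintro ⟨x, hx⟩ i hi
    have h := hx i hi
    rw [key x hx, hY i] at h
    simpa using h
  · intro h
    exact ⟨xstar, fun i hi => by rw [hY i, h i hi, add_zero]⟩
end

section
/- Suppose 2s̄ ≤ p and the system is 2s̄-sparse observable. Let I ⊆ {1,…,p} with |I| > p − 2s̄ and suppose ⋂_{i∈I} H_i = ∅, where H_i = {x ∈ ℝⁿ : Y_i = O_i x}. Then there exists a subset I_temp ⊆ I with |I_temp| ≤ p − 2s̄ + 1 such that ⋂_{i∈I_temp} H_i = ∅. -/
/-- Suppose 2s̄ ≤ p and the system is 2s̄-sparse observable. Let I ⊆ {1,…,p}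
with |I| > p − 2s̄ and suppose ⋂_{i∈I} H_i = ∅, where H_i = {x : Y_i = O_i x}. Then there
is a subset I_temp ⊆ I with |I_temp| ≤ p − 2s̄ + 1 such that ⋂_{i∈I_temp} H_i = ∅. -/
theorem stmt_5 {p τ n : ℕ} (sbar : ℕ) (hs : 2 * sbar ≤ p)
    (O : Fin p → Matrix (Fin τ) (Fin n) ℝ)
    (hobs : SparseObservable O (2 * sbar))
    (Y : Fin p → Fin τ → ℝ)
    (H : Fin p → Set (Fin n → ℝ))
    (hH : ∀ i, H i = {x : Fin n → ℝ | Y i = (O i).mulVec x})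
    (I : Finset (Fin p)) (hI : p - 2 * sbar < I.card)
    (hempty : (⋂ i ∈ I, H i) = ∅) :
    ∃ Itemp : Finset (Fin p), Itemp ⊆ I ∧ Itemp.card ≤ p - 2 * sbar + 1 ∧
      (⋂ i ∈ Itemp, H i) = ∅ := by
  classical
  obtain ⟨J, hJI, hJ⟩ := Finset.exists_subset_card_eq hI.le
  by_cases hJe : (⋂ i ∈ J, H i) = ∅
  · exact ⟨J, hJI, by omega, hJe⟩
  obtain ⟨x, hx⟩ := Set.nonempty_iff_ne_empty.mpr hJe
  have hxI : x ∉ ⋂ i ∈ I, H i := by rw [hempty]; exact Set.notMem_empty x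
  simp only [Set.mem_iInter, not_forall] at hxI hx
  obtain ⟨i, hi, hxi⟩ := hxI
  refine ⟨insert i J, Finset.insert_subset hi hJI, ?_, ?_⟩
  · have := Finset.card_insert_le i J
    omega
  · rw [Set.eq_empty_iff_forall_notMem]
    intro y hy
    simp only [Set.mem_iInter] at hy
    have hyx : y - x = 0 := by
      apply hobs Jᶜ
      · rw [Finset.card_compl, Fintype.card_fin, hJ]
        omega
      · intro j hj
        rw [compl_compl] at hj
        have h1 := hx j hj
        have h2 := hy j (Finset.mem_insert_of_mem hj)
        rw [hH] at h1 h2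
        simp only [Set.mem_setOf_eq] at h1 h2
        rw [Matrix.mulVec_sub, ← h1, ← h2, sub_self]
    rw [sub_eq_zero] at hyx
    subst hyx
    exact hxi (hy i (Finset.mem_insert_self i J))
end

section
/- Suppose 3s̄ ≤ p, the system is 3s̄-sparse observable, and the measurements satisfy Y_i = O_i x* + E*_i for all i ∈ {1,…,p}, where x* ∈ ℝⁿ and E* is block-s̄-sparse. Let I ⊆ {1,…,p} with |I| ≥ p − 2s̄. If there exists x ∈ ℝⁿ with O_i x = Y_i for all i ∈ I, then x = x* and E*_i = 0 for all i ∈ I (so all sensors in I are attack-free). -/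
/-- Suppose 3s̄ ≤ p, the system is 3s̄-sparse observable, and
Y_i = O_i x* + E*_i for all i, with E* block-s̄-sparse. Let I ⊆ {1,…,p} with
|I| ≥ p − 2s̄. If there exists x with O_i x = Y_i for all i ∈ I, then x = x* and
E*_i = 0 for all i ∈ I. -/
theorem stmt_7 {p τ n : ℕ} (sbar : ℕ) (hs : 3 * sbar ≤ p)
    (O : Fin p → Matrix (Fin τ) (Fin n) ℝ)
    (hobs : SparseObservable O (3 * sbar))
    (Y Estar : Fin p → Fin τ → ℝ) (xstar : Fin n → ℝ)
    (hY : ∀ i : Fin p, Y i = (O i).mulVec xstar + Estar i)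
    (hE : BlockSparse Estar sbar)
    (I : Finset (Fin p)) (hI : p - 2 * sbar ≤ I.card) :
    ∀ x : Fin n → ℝ, (∀ i ∈ I, (O i).mulVec x = Y i) →
      x = xstar ∧ ∀ i ∈ I, Estar i = 0 := by
  intro x hx
  obtain ⟨S, hS, hES⟩ := hE
  have hcard : (Iᶜ ∪ S).card ≤ 3 * sbar := by
    have h1 := Finset.card_union_le Iᶜ S
    have h2 : Iᶜ.card = p - I.card := by simp [Finset.card_compl]
    omega
  obtain ⟨Γ, hΓ, hΓc⟩ := Finset.exists_superset_card_eq hcard (by simpa using hs)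
  have hxx : x = xstar := by
    have h0 : x - xstar = 0 := by
      refine hobs Γ hΓc _ fun i hi => ?_
      have hi' : i ∉ Iᶜ ∪ S := fun h => (Finset.mem_compl.mp hi) (hΓ h)
      simp only [Finset.mem_union, Finset.mem_compl, not_or, not_not] at hi'
      rw [Matrix.mulVec_sub, hx i hi'.1, hY i, hES i hi'.2, add_zero, sub_self]
    exact sub_eq_zero.mp h0
  refine ⟨hxx, fun i hi => ?_⟩
  have h := hx i hi
  rw [hY i, hxx] at h
  exact left_eq_add.mp h
end

section
/- Suppose 2s̄ ≤ p, the system is 2s̄-sparse observable, and the measurements satisfy Y_i = O_i x* + E*_i for all i ∈ {1,…,p}, where x* ∈ ℝⁿ and E* is block-s̄-sparse. Then for any b ∈ {0,1}^p with Σ_{i=1}^p b_i ≤ s̄ and any x ∈ ℝⁿ such that O_i x = Y_i for all i with b_i = 0, it holds that x = x* and every index i with E*_i ≠ 0 satisfies b_i = 1 (i.e., supp(E*) ⊆ supp(b)). In other words, in the noiseless case any satisfying assignment of the secure state estimation problem recovers the true state exactly and its attack indicator covers the true attack support. -/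
/-- Suppose 2s̄ ≤ p, the system is 2s̄-sparse observable, and
Y_i = O_i x* + E*_i for all i, with E* block-s̄-sparse. Then for any b ∈ {0,1}^p with
Σ b_i ≤ s̄ and any x with O_i x = Y_i for all i with b_i = 0, it holds that x = x* and
supp(E*) ⊆ supp(b). -/
theorem stmt_8 {p τ n : ℕ} (sbar : ℕ) (hs : 2 * sbar ≤ p)
    (O : Fin p → Matrix (Fin τ) (Fin n) ℝ)
    (hobs : SparseObservable O (2 * sbar))
    (Y Estar : Fin p → Fin τ → ℝ) (xstar : Fin n → ℝ)
    (hY : ∀ i : Fin p, Y i = (O i).mulVec xstar + Estar i)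
    (hE : BlockSparse Estar sbar) :
    ∀ b : Fin p → Bool, (Finset.univ.filter fun i => b i = true).card ≤ sbar →
      ∀ x : Fin n → ℝ, (∀ i : Fin p, b i = false → (O i).mulVec x = Y i) →
        x = xstar ∧ ∀ i : Fin p, Estar i ≠ 0 → b i = true := by
  intro b hb x hx
  obtain ⟨S, hS, hSE⟩ := hE
  have hcard : (S ∪ Finset.univ.filter fun i => b i = true).card ≤ 2 * sbar :=
    (Finset.card_union_le _ _).trans (by omega)
  obtain ⟨Γ, hsub, hΓ⟩ := Finset.exists_superset_card_eq hcard (by simpa using hs)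
  have hxx : x = xstar := by
    refine sub_eq_zero.mp (hobs Γ hΓ (x - xstar) ?_)
    intro i hi
    have hi' : i ∉ Γ := by simpa using hi
    have h1 : i ∉ S := fun h => hi' (hsub (Finset.mem_union_left _ h))
    have h2 : b i = false := by
      by_contra h
      exact hi' (hsub (Finset.mem_union_right _ (by simpa using h)))
    rw [Matrix.mulVec_sub, hx i h2, hY i, hSE i h1]
    simp
  refine ⟨hxx, fun i hi => ?_⟩
  by_contra h
  have h3 := hx i (by simpa using h)
  rw [hxx, hY i] at h3
  exact hi (by simpa using h3)
end

section
/- Suppose 2s̄ ≤ p and the system is 2s̄-sparse observable. Let Γ ⊂ I ⊆ {1,…,p} with |Γ| ≤ s̄ and |I| ≥ p − s̄. Then the matrix Σ_{i∈I} O_iᵀO_i is invertible, and every eigenvalue λ of the matrix (Σ_{i∈Γ} O_iᵀO_i)(Σ_{i∈I} O_iᵀO_i)⁻¹ is real and satisfies λ < 1. -/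
open Matrix

theorem aux_quad {p τ n : ℕ} (O : Fin p → Matrix (Fin τ) (Fin n) ℝ) (S : Finset (Fin p))
    (x : Fin n → ℝ) :
    x ⬝ᵥ ((∑ i ∈ S, (O i)ᵀ * O i) *ᵥ x) = ∑ i ∈ S, (O i *ᵥ x) ⬝ᵥ (O i *ᵥ x) := by
  rw [Matrix.sum_mulVec, dotProduct_sum]
  refine Finset.sum_congr rfl fun i _ => ?_
  rw [← Matrix.mulVec_mulVec, Matrix.dotProduct_mulVec, Matrix.vecMul_transpose]

theorem aux_symm {p τ n : ℕ} (O : Fin p → Matrix (Fin τ) (Fin n) ℝ) (S : Finset (Fin p))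
    (x y : Fin n → ℝ) :
    x ⬝ᵥ ((∑ i ∈ S, (O i)ᵀ * O i) *ᵥ y) = y ⬝ᵥ ((∑ i ∈ S, (O i)ᵀ * O i) *ᵥ x) := by
  rw [Matrix.sum_mulVec, dotProduct_sum, Matrix.sum_mulVec, dotProduct_sum]
  refine Finset.sum_congr rfl fun i _ => ?_
  rw [← Matrix.mulVec_mulVec, Matrix.dotProduct_mulVec, Matrix.vecMul_transpose,
    ← Matrix.mulVec_mulVec, Matrix.dotProduct_mulVec y, Matrix.vecMul_transpose, dotProduct_comm]

theorem aux_nonneg {m : ℕ} (x : Fin m → ℝ) : 0 ≤ x ⬝ᵥ x :=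
  Finset.sum_nonneg fun i _ => mul_self_nonneg (x i)

theorem aux_lt {p τ n : ℕ} (sbar : ℕ) (hs : 2 * sbar ≤ p)
    (O : Fin p → Matrix (Fin τ) (Fin n) ℝ)
    (hobs : SparseObservable O (2 * sbar))
    (Γ I : Finset (Fin p)) (hΓI : Γ ⊂ I)
    (hΓ : Γ.card ≤ sbar) (hI : p - sbar ≤ I.card) (x : Fin n → ℝ) (hx : x ≠ 0) :
    x ⬝ᵥ ((∑ i ∈ Γ, (O i)ᵀ * O i) *ᵥ x) < x ⬝ᵥ ((∑ i ∈ I, (O i)ᵀ * O i) *ᵥ x) := by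
  rw [aux_quad, aux_quad, ← Finset.sum_sdiff hΓI.1]
  have hpos : 0 < ∑ i ∈ I \ Γ, (O i *ᵥ x) ⬝ᵥ (O i *ᵥ x) := by
    refine lt_of_le_of_ne (Finset.sum_nonneg fun i _ => aux_nonneg _) fun h0 => hx ?_
    have h1 := (Finset.sum_eq_zero_iff_of_nonneg (fun i _ => aux_nonneg (O i *ᵥ x))).1 h0.symm
    have hc : ((I \ Γ)ᶜ).card ≤ 2 * sbar := by
      rw [Finset.card_compl, Finset.card_sdiff_of_subset hΓI.1, Fintype.card_fin]
      omega
    obtain ⟨T, hT, hTc⟩ := Finset.exists_superset_card_eq hc (by simpa using hs)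
    refine hobs T hTc x fun i hi => ?_
    refine dotProduct_self_eq_zero.1 (h1 i ?_)
    by_contra hn
    exact (Finset.mem_compl.1 hi) (hT (Finset.mem_compl.2 hn))
  linarith

/-- Suppose 2s̄ ≤ p and the system is 2s̄-sparse observable. Let Γ ⊂ I with
|Γ| ≤ s̄ and |I| ≥ p − s̄. Then Σ_{i∈I} O_iᵀO_i is invertible and every eigenvalue of
(Σ_{i∈Γ} O_iᵀO_i)(Σ_{i∈I} O_iᵀO_i)⁻¹ is real and < 1. -/
theorem stmt_9 {p τ n : ℕ} (sbar : ℕ) (hs : 2 * sbar ≤ p)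
    (O : Fin p → Matrix (Fin τ) (Fin n) ℝ)
    (hobs : SparseObservable O (2 * sbar))
    (Γ I : Finset (Fin p)) (hΓI : Γ ⊂ I)
    (hΓ : Γ.card ≤ sbar) (hI : p - sbar ≤ I.card) :
    IsUnit (∑ i ∈ I, (O i)ᵀ * O i) ∧
      ∀ μ : ℂ,
        μ ∈ spectrum ℂ
          (((∑ i ∈ Γ, (O i)ᵀ * O i) * (∑ i ∈ I, (O i)ᵀ * O i)⁻¹).map (fun a => (a : ℂ))) →
        μ.im = 0 ∧ μ.re < 1 := by
  have hlt := aux_lt sbar hs O hobs Γ I hΓI hΓ hI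
  have hsA := aux_symm O Γ
  have hsB := aux_symm O I
  have hA0 : ∀ x : Fin n → ℝ, 0 ≤ x ⬝ᵥ ((∑ i ∈ Γ, (O i)ᵀ * O i) *ᵥ x) := fun x => by
    rw [aux_quad]; exact Finset.sum_nonneg fun i _ => aux_nonneg _
  generalize (∑ i ∈ Γ, (O i)ᵀ * O i) = A at *
  generalize (∑ i ∈ I, (O i)ᵀ * O i) = B at *
  have hdet : B.det ≠ 0 := by
    intro h
    obtain ⟨v, hv, hBv⟩ := Matrix.exists_mulVec_eq_zero_iff.2 h
    have := hlt v hv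
    rw [hBv, dotProduct_zero] at this
    linarith [hA0 v]
  have hU : IsUnit B := (Matrix.isUnit_iff_isUnit_det B).2 (isUnit_iff_ne_zero.2 hdet)
  refine ⟨hU, fun μ hμ => ?_⟩
  set f : ℝ →+* ℂ := Complex.ofRealHom with hf
  have hdet0 : (μ • B.map f - A.map f).det = 0 := by
    rw [spectrum.mem_iff, Matrix.isUnit_iff_isUnit_det, isUnit_iff_ne_zero, not_not] at hμ
    have e : μ • B.map f - A.map f =
        (algebraMap ℂ (Matrix (Fin n) (Fin n) ℂ) μ - (A * B⁻¹).map f) * B.map f := by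
      rw [sub_mul, ← Matrix.map_mul, Matrix.mul_assoc,
        Matrix.nonsing_inv_mul _ (isUnit_iff_ne_zero.2 hdet), Matrix.mul_one,
        Algebra.algebraMap_eq_smul_one, smul_mul_assoc, one_mul]
    rw [e, Matrix.det_mul]
    exact mul_eq_zero_of_left hμ _
  obtain ⟨v, hv, hv0⟩ := Matrix.exists_mulVec_eq_zero_iff.2 hdet0
  set x : Fin n → ℝ := fun k => (v k).re with hx
  set y : Fin n → ℝ := fun k => (v k).im with hy
  have key : ∀ M : Matrix (Fin n) (Fin n) ℝ, ∀ j,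
      ((M.map f *ᵥ v) j).re = (M *ᵥ x) j ∧ ((M.map f *ᵥ v) j).im = (M *ᵥ y) j := by
    intro M j
    simp [Matrix.mulVec, dotProduct, hf, hx, hy]
  have hvj : ∀ j, μ * (B.map f *ᵥ v) j = (A.map f *ᵥ v) j := by
    intro j
    have := congrFun hv0 j
    rw [Matrix.sub_mulVec, Matrix.smul_mulVec] at this
    simpa [sub_eq_zero] using this
  have e1 : A *ᵥ x = μ.re • (B *ᵥ x) - μ.im • (B *ᵥ y) := by
    ext j
    have := congrArg Complex.re (hvj j)
    rw [Complex.mul_re, (key B j).1, (key B j).2, (key A j).1] at this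
    simp [← this]
  have e2 : A *ᵥ y = μ.re • (B *ᵥ y) + μ.im • (B *ᵥ x) := by
    ext j
    have := congrArg Complex.im (hvj j)
    rw [Complex.mul_im, (key B j).1, (key B j).2, (key A j).2] at this
    simp [← this]
  have hle : ∀ z : Fin n → ℝ, z ⬝ᵥ (A *ᵥ z) ≤ z ⬝ᵥ (B *ᵥ z) := fun z => by
    by_cases hz : z = 0
    · simp [hz]
    · exact (hlt z hz).le
  have hsum : x ⬝ᵥ (A *ᵥ x) + y ⬝ᵥ (A *ᵥ y) < x ⬝ᵥ (B *ᵥ x) + y ⬝ᵥ (B *ᵥ y) := by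
    by_cases hx0 : x = 0
    · have hy0 : y ≠ 0 := fun hy0 => hv (by
        ext k
        exact Complex.ext (congrFun hx0 k) (congrFun hy0 k))
      linarith [hle x, hlt y hy0]
    · linarith [hle y, hlt x hx0]
  have hpos : 0 < x ⬝ᵥ (B *ᵥ x) + y ⬝ᵥ (B *ᵥ y) := by linarith [hA0 x, hA0 y]
  have r1 := congrArg (fun w => x ⬝ᵥ w) e1
  have r2 := congrArg (fun w => y ⬝ᵥ w) e2
  have r3 := congrArg (fun w => y ⬝ᵥ w) e1
  have r4 := congrArg (fun w => x ⬝ᵥ w) e2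
  simp only [dotProduct_sub, dotProduct_add, dotProduct_smul, smul_eq_mul] at r1 r2 r3 r4
  have sB := hsB x y
  have sA := hsA x y
  rw [sB] at r1 r4
  rw [sA] at r4
  constructor
  · have : μ.im * (x ⬝ᵥ (B *ᵥ x) + y ⬝ᵥ (B *ᵥ y)) = 0 := by linarith
    exact (mul_eq_zero.1 this).resolve_right hpos.ne'
  · have : μ.re * (x ⬝ᵥ (B *ᵥ x) + y ⬝ᵥ (B *ᵥ y)) = x ⬝ᵥ (A *ᵥ x) + y ⬝ᵥ (A *ᵥ y) := by
      linarith
    by_contra hge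
    nlinarith
end

section
/- Let I ⊆ {1,…,p} be such that O_IᵀO_I is invertible, let O_I⁺ = (O_IᵀO_I)⁻¹O_Iᵀ, let Γ ⊆ I, and let Δ ∈ ℝ be such that vᵀ O_Γ (O_IᵀO_I)⁻¹ O_Γᵀ v ≤ Δ‖v‖² for all vectors v (i.e., Δ is an upper bound on the largest eigenvalue of O_Γ(O_IᵀO_I)⁻¹O_Γᵀ). Then for every block vector E with E_i = 0 for all i ∈ I∖Γ, it holds that ‖(Id − O_I O_I⁺) E_I‖² ≥ (1 − Δ)‖E_I‖². (With Δ = Δ_s, the maximum of these eigenvalue bounds over all Γ ⊂ I with |Γ| ≤ s̄ and |I| ≥ p − s̄, this is the key inequality of the paper's Definition-and-Proposition on Δ_s.) -/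
open Matrix

/-- Vertical stacking of the observability blocks `O i`, `i ∈ I`. -/
def stackM {p τ n : ℕ} (O : Fin p → Matrix (Fin τ) (Fin n) ℝ) (I : Finset (Fin p)) :
    Matrix (({i // i ∈ I}) × Fin τ) (Fin n) ℝ :=
  fun q j => O q.1.1 q.2 j

/-- Vertical stacking of the blocks `E i`, `i ∈ I`, of a block vector. -/
def stackV {p τ : ℕ} (E : Fin p → Fin τ → ℝ) (I : Finset (Fin p)) :
    (({i // i ∈ I}) × Fin τ) → ℝ :=
  fun q => E q.1.1 q.2

/-- Squared Euclidean norm of a vector. -/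
def sqNorm {ι : Type*} [Fintype ι] (v : ι → ℝ) : ℝ := ∑ i, (v i) ^ 2

theorem sum_stack_eq {p τ : ℕ} (I Γ : Finset (Fin p)) (hΓ : Γ ⊆ I)
    (g : Fin p → Fin τ → ℝ) (hg : ∀ i ∈ I, i ∉ Γ → ∀ t, g i t = 0) :
    ∑ q : {i // i ∈ I} × Fin τ, g q.1.1 q.2 = ∑ q : {i // i ∈ Γ} × Fin τ, g q.1.1 q.2 := by
  rw [Fintype.sum_prod_type, Fintype.sum_prod_type]
  have h1 := Finset.sum_coe_sort I (fun i => ∑ t, g i t)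
  have h2 := Finset.sum_coe_sort Γ (fun i => ∑ t, g i t)
  refine h1.trans (Eq.trans ?_ h2.symm)
  symm
  apply Finset.sum_subset hΓ
  intro i hi hn
  exact Finset.sum_eq_zero fun t _ => hg i hi hn t

theorem sqNorm_eq_dot {ι : Type*} [Fintype ι] (v : ι → ℝ) : sqNorm v = v ⬝ᵥ v := by
  simp [sqNorm, dotProduct, sq]

theorem quad_eq {m n : Type*} [Fintype m] [Fintype n] (A : Matrix m n ℝ)
    (K : Matrix n n ℝ) (e : m → ℝ) :
    e ⬝ᵥ ((A * K * Aᵀ) *ᵥ e) = (Aᵀ *ᵥ e) ⬝ᵥ (K *ᵥ (Aᵀ *ᵥ e)) := by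
  rw [← Matrix.mulVec_mulVec, ← Matrix.mulVec_mulVec, Matrix.dotProduct_mulVec,
    ← Matrix.mulVec_transpose]

theorem resid_eq {m : Type*} [Fintype m] [DecidableEq m] (P : Matrix m m ℝ)
    (hs : Pᵀ = P) (hi : P * P = P) (e : m → ℝ) :
    sqNorm ((1 - P) *ᵥ e) = sqNorm e - e ⬝ᵥ (P *ᵥ e) := by
  have h : (P *ᵥ e) ⬝ᵥ (P *ᵥ e) = e ⬝ᵥ (P *ᵥ e) := by
    rw [Matrix.dotProduct_mulVec, ← Matrix.mulVec_transpose, hs, Matrix.mulVec_mulVec, hi,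
      dotProduct_comm]
  rw [sqNorm_eq_dot, sqNorm_eq_dot, Matrix.sub_mulVec, Matrix.one_mulVec, sub_dotProduct,
    dotProduct_sub, dotProduct_sub, h, dotProduct_comm (P *ᵥ e) e]
  ring

/-- Let I be such that O_IᵀO_I is invertible, O_I⁺ = (O_IᵀO_I)⁻¹O_Iᵀ,
Γ ⊆ I, and Δ an upper bound on the quadratic form of O_Γ(O_IᵀO_I)⁻¹O_Γᵀ (i.e. an upper
bound on its largest eigenvalue). Then for every block vector E with E_i = 0 for all
i ∈ I∖Γ: ‖(Id − O_I O_I⁺) E_I‖² ≥ (1 − Δ)‖E_I‖². -/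
theorem stmt_11 {p τ n : ℕ}
    (O : Fin p → Matrix (Fin τ) (Fin n) ℝ)
    (I : Finset (Fin p)) (hInv : IsUnit ((stackM O I)ᵀ * stackM O I))
    (Γ : Finset (Fin p)) (hΓ : Γ ⊆ I)
    (Δ : ℝ)
    (hΔ : ∀ v : ({i // i ∈ Γ}) × Fin τ → ℝ,
      v ⬝ᵥ ((stackM O Γ * ((stackM O I)ᵀ * stackM O I)⁻¹ * (stackM O Γ)ᵀ).mulVec v)
        ≤ Δ * sqNorm v)
    (E : Fin p → Fin τ → ℝ) (hE : ∀ i ∈ I \ Γ, E i = 0) :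
    sqNorm
      ((1 - stackM O I * (((stackM O I)ᵀ * stackM O I)⁻¹ * (stackM O I)ᵀ)).mulVec
        (stackV E I))
      ≥ (1 - Δ) * sqNorm (stackV E I) := by
  have hE' : ∀ i ∈ I, i ∉ Γ → E i = 0 := fun i hi hn => hE i (Finset.mem_sdiff.2 ⟨hi, hn⟩)
  have hw : (stackM O I)ᵀ *ᵥ stackV E I = (stackM O Γ)ᵀ *ᵥ stackV E Γ := by
    funext j
    exact sum_stack_eq I Γ hΓ (fun i t => O i t j * E i t)
      (fun i hi hn t => by simp [hE' i hi hn])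
  have hn : sqNorm (stackV E I) = sqNorm (stackV E Γ) :=
    sum_stack_eq I Γ hΓ (fun i t => E i t ^ 2) (fun i hi hn t => by simp [hE' i hi hn])
  have hd := (Matrix.isUnit_iff_isUnit_det _).1 hInv
  have hq := hΔ (stackV E Γ)
  rw [quad_eq, ← hw, ← quad_eq, ← hn] at hq
  rw [← Matrix.mul_assoc, resid_eq]
  · linarith
  · simp [Matrix.transpose_mul, Matrix.transpose_nonsing_inv, Matrix.mul_assoc]
  · generalize stackM O I = A at hd
    calc A * (Aᵀ * A)⁻¹ * Aᵀ * (A * (Aᵀ * A)⁻¹ * Aᵀ)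
        = A * ((Aᵀ * A)⁻¹ * (Aᵀ * A)) * (Aᵀ * A)⁻¹ * Aᵀ := by simp only [Matrix.mul_assoc]
      _ = _ := by rw [Matrix.nonsing_inv_mul _ hd, Matrix.mul_one]
end

section
/- Let I ⊆ {1,…,p} be such that O_IᵀO_I is invertible and suppose Y_I = O_I x* + Ψ_I + E_I for some x* ∈ ℝⁿ, noise Ψ_I, and attack E_I. Let ε > 0, Δ < 1, ō ≥ 0, and ‖Ψ‖ ≥ 0 be such that ‖O_I⁺‖² ≤ ō, ‖Ψ_I‖ ≤ ‖Ψ‖, and ‖E_I‖² ≤ (2/(1 − Δ))‖Ψ‖² + ε/(1 − Δ) (i.e., the attack is small enough to be undetected). Then the least-squares estimate x = O_I⁺ Y_I satisfies ‖x* − x‖² ≤ 2ō(1 + 2/(1 − Δ))‖Ψ‖² + 2ōε/(1 − Δ). -/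
open Matrix

/-- The induced 2-norm (operator norm w.r.t. Euclidean norms) of a real matrix. -/
noncomputable def opNorm2 {m n : Type*} [Fintype m] [Fintype n] [DecidableEq n]
    (M : Matrix m n ℝ) : ℝ :=
  ‖LinearMap.toContinuousLinearMap (Matrix.toEuclideanLin M)‖

/-- Operator norm bound on squared norms. -/
theorem sqNorm_mulVec_le {m n : Type*} [Fintype m] [Fintype n] [DecidableEq n]
    (M : Matrix m n ℝ) (v : n → ℝ) :
    sqNorm (M.mulVec v) ≤ opNorm2 M ^ 2 * sqNorm v := by
  have h := (LinearMap.toContinuousLinearMap (Matrix.toEuclideanLin M)).le_opNorm (WithLp.toLp 2 v)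
  have h2 := pow_le_pow_left₀ (norm_nonneg _) h 2
  rw [mul_pow, EuclideanSpace.norm_sq_eq, EuclideanSpace.norm_sq_eq] at h2
  simpa [sqNorm, opNorm2] using h2

theorem sqNorm_add_le {m : Type*} [Fintype m] (v w : m → ℝ) :
    sqNorm (v + w) ≤ 2 * sqNorm v + 2 * sqNorm w := by
  unfold sqNorm
  rw [Finset.mul_sum, Finset.mul_sum, ← Finset.sum_add_distrib]
  apply Finset.sum_le_sum
  intro i _
  simp only [Pi.add_apply]
  nlinarith [sq_nonneg (v i - w i)]

/-- Let I be such that O_IᵀO_I is invertible and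
Y_I = O_I x* + Ψ_I + E_I. Let ε > 0, Δ < 1, ō ≥ 0, ‖Ψ‖ ≥ 0 with ‖O_I⁺‖² ≤ ō,
‖Ψ_I‖ ≤ ‖Ψ‖, and ‖E_I‖² ≤ (2/(1 − Δ))‖Ψ‖² + ε/(1 − Δ). Then x = O_I⁺ Y_I satisfies
‖x* − x‖² ≤ 2ō(1 + 2/(1 − Δ))‖Ψ‖² + 2ōε/(1 − Δ). -/
theorem stmt_15 {p τ n : ℕ}
    (O : Fin p → Matrix (Fin τ) (Fin n) ℝ)
    (Y Ψ E : Fin p → Fin τ → ℝ)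
    (I : Finset (Fin p)) (hInv : IsUnit ((stackM O I)ᵀ * stackM O I))
    (xstar : Fin n → ℝ)
    (hY : ∀ i ∈ I, Y i = (O i).mulVec xstar + Ψ i + E i)
    (ε : ℝ) (hε : 0 < ε) (Δ : ℝ) (hΔ : Δ < 1)
    (obar : ℝ) (hobar : 0 ≤ obar) (nΨ : ℝ) (hnΨ : 0 ≤ nΨ)
    (hop : (opNorm2 (((stackM O I)ᵀ * stackM O I)⁻¹ * (stackM O I)ᵀ)) ^ 2 ≤ obar)
    (hΨ : sqNorm (stackV Ψ I) ≤ nΨ ^ 2)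
    (hE : sqNorm (stackV E I) ≤ 2 / (1 - Δ) * nΨ ^ 2 + ε / (1 - Δ)) :
    sqNorm
        (xstar - (((stackM O I)ᵀ * stackM O I)⁻¹ * (stackM O I)ᵀ).mulVec (stackV Y I))
      ≤ 2 * obar * (1 + 2 / (1 - Δ)) * nΨ ^ 2 + 2 * obar * ε / (1 - Δ) := by
  have hst : stackV Y I = (stackM O I).mulVec xstar + (stackV Ψ I + stackV E I) := by
    funext q
    have := congrFun (hY q.1.1 q.1.2) q.2
    simp only [stackV, Pi.add_apply, this, add_assoc]
    rfl
  have hd : IsUnit ((stackM O I)ᵀ * stackM O I).det := (Matrix.isUnit_iff_isUnit_det _).1 hInv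
  have hx : xstar - (((stackM O I)ᵀ * stackM O I)⁻¹ * (stackM O I)ᵀ).mulVec (stackV Y I)
      = -(((stackM O I)ᵀ * stackM O I)⁻¹ * (stackM O I)ᵀ).mulVec (stackV Ψ I + stackV E I) := by
    rw [hst, Matrix.mulVec_add _ ((stackM O I).mulVec xstar), Matrix.mulVec_mulVec,
      Matrix.mul_assoc, Matrix.nonsing_inv_mul _ hd, Matrix.one_mulVec]
    abel
  have hneg : ∀ v : Fin n → ℝ, sqNorm (-v) = sqNorm v := fun v => by simp [sqNorm]
  rw [hx, hneg]
  have h1 := sqNorm_mulVec_le (((stackM O I)ᵀ * stackM O I)⁻¹ * (stackM O I)ᵀ)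
    (stackV Ψ I + stackV E I)
  have h2 := sqNorm_add_le (stackV Ψ I) (stackV E I)
  have h0 : 0 ≤ sqNorm (stackV Ψ I + stackV E I) := Finset.sum_nonneg fun i _ => sq_nonneg _
  calc _ ≤ _ := h1
    _ ≤ obar * sqNorm (stackV Ψ I + stackV E I) := mul_le_mul_of_nonneg_right hop h0
    _ ≤ obar * (2 * nΨ ^ 2 + 2 * (2 / (1 - Δ) * nΨ ^ 2 + ε / (1 - Δ))) :=
      mul_le_mul_of_nonneg_left (by linarith) hobar
    _ = _ := by ring
end
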